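/- Let G be a finite group of order 2^n (n ≥ 1) with a unique involution. Then G is cyclic or a generalized quaternion group. -/

import Mathlib

open Subgroup

/-- A nontrivial normal subgroup of a finite `p`-group contains a central element of order `p`. -/
theorem IsPGroup.exists_mem_center_orderOf_eq_of_normal {G : Type*} [Group G] [Finite G] {p : ℕ}
    [hp : Fact p.Prime] (hG : IsPGroup p G) (N : Subgroup G) [N.Normal] (hN : N ≠ ⊥) :
    ∃ c ∈ N, c ∈ center G ∧ orderOf c = p := by
  have hdvd : p ∣ Nat.card N := by
    obtain ⟨k, hk⟩ := IsPGroup.iff_card.mp (hG.to_subgroup N)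
    have hk0 : k ≠ 0 := by
      rintro rfl
      exact hN (N.eq_bot_of_card_eq (by simpa using hk))
    exact hk ▸ dvd_pow_self p hk0
  obtain ⟨b, hb, hb1⟩ :=
    (hG.of_equiv ConjAct.toConjAct).exists_fixed_point_of_prime_dvd_card_of_fixed_point N hdvd
      (a := 1) (fun g => smul_one g)
  have hbc : (b : G) ∈ center G := by
    rw [mem_center_iff]
    intro g
    have h := congrArg Subtype.val (hb (ConjAct.toConjAct g))
    rw [ConjAct.Subgroup.val_conj_smul, ConjAct.toConjAct_smul] at h
    exact mul_inv_eq_iff_eq_mul.mp h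
  have hb0 : (b : G) ≠ 1 := fun h => hb1 (Subtype.ext h.symm)
  obtain ⟨k, hk⟩ := IsPGroup.iff_orderOf.mp hG (b : G)
  have hk0 : k ≠ 0 := by
    rintro rfl
    exact hb0 (orderOf_eq_one_iff.mp (by simpa using hk))
  have hpb : p ∣ orderOf (b : G) := hk ▸ dvd_pow_self p hk0
  refine ⟨(b : G) ^ (orderOf (b : G) / p), pow_mem b.2 _, pow_mem hbc _, ?_⟩
  exact orderOf_pow_orderOf_div (orderOf_pos _).ne' hpb

section TwoGroup

variable {G : Type*} [Group G]

theorem IsPGroup.exists_pow_pow_eq_self_of_odd (hG : IsPGroup 2 G) (g : G) {u : ℕ} (hu : Odd u) :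
    ∃ m : ℕ, (g ^ u) ^ m = g := by
  obtain ⟨k, hk⟩ := IsPGroup.iff_orderOf.mp hG g
  exact exists_pow_eq_self_of_coprime (hk ▸ hu.coprime_two_right.pow_right k)

/-- An element of a cyclic 2-group is a square or a generator. -/
theorem IsPGroup.exists_sq_eq_or_mem_zpowers [Finite G] (hG : IsPGroup 2 G) {a c : G}
    (hc : c ∈ zpowers a) : (∃ d ∈ zpowers a, d ^ 2 = c) ∨ a ∈ zpowers c := by
  obtain ⟨s, rfl⟩ := mem_powers_iff_mem_zpowers.mpr hc
  rcases Nat.even_or_odd s with ⟨t, rfl⟩ | hs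
  · exact .inl ⟨a ^ t, pow_mem (mem_zpowers a) t, by simp only [← pow_mul, mul_two]⟩
  · obtain ⟨m, hm⟩ := hG.exists_pow_pow_eq_self_of_odd a hs
    have h := pow_mem (mem_zpowers (a ^ s)) m
    rw [hm] at h
    exact .inr h

variable {z : G}

theorem eq_one_or_eq_of_sq_eq_one (hz : ∀ y : G, orderOf y = 2 → y = z) {y : G}
    (hy : y ^ 2 = 1) : y = 1 ∨ y = z := by
  by_cases h : y = 1
  · exact .inl h
  · exact .inr (hz y (orderOf_eq_prime hy h))

theorem IsPGroup.exists_pow_eq_involution [Finite G] (hG : IsPGroup 2 G)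
    (hz : ∀ y : G, orderOf y = 2 → y = z) {g : G} (hg : g ≠ 1) : ∃ t : ℕ, g ^ t = z := by
  obtain ⟨k, hk⟩ := IsPGroup.iff_orderOf.mp hG g
  have hk0 : k ≠ 0 := by
    rintro rfl
    exact hg (orderOf_eq_one_iff.mp (by simpa using hk))
  exact ⟨orderOf g / 2,
    hz _ (orderOf_pow_orderOf_div (orderOf_pos _).ne' (hk ▸ dvd_pow_self 2 hk0))⟩

theorem conj_eq_of_unique_involution (hz2 : orderOf z = 2)
    (hz : ∀ y : G, orderOf y = 2 → y = z) (g : G) : g * z * g⁻¹ = z :=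
  hz _ (by rw [← MulAut.conj_apply, MulEquiv.orderOf_eq, hz2])

/-- In a finite 2-group with a unique involution, a nontrivial maximal cyclic normal subgroup
is self-centralizing. -/
theorem mem_zpowers_of_commute_of_maximal [Finite G] (hG : IsPGroup 2 G)
    (hz : ∀ y : G, orderOf y = 2 → y = z) {a : G} (ha : (zpowers a).Normal) (hza : z ∈ zpowers a)
    (hmax : ∀ b : G, (zpowers b).Normal → a ∈ zpowers b → b ∈ zpowers a)
    {g : G} (hg : Commute g a) : g ∈ zpowers a := by
  by_contra hga
  let N := (centralizer (zpowers a : Set G)).map (QuotientGroup.mk' (zpowers a))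
  have : N.Normal := Subgroup.Normal.map inferInstance _ (QuotientGroup.mk'_surjective _)
  have hN : N ≠ ⊥ := by
    intro h
    have hgN : (g : G ⧸ zpowers a) ∈ N := by
      refine ⟨g, ?_, rfl⟩
      rintro _ ⟨i, rfl⟩
      exact (hg.zpow_right i).eq.symm
    rw [h, mem_bot, QuotientGroup.eq_one_iff] at hgN
    exact hga hgN
  obtain ⟨_, ⟨c, hcA, rfl⟩, hcc, hc2⟩ :=
    (hG.to_quotient (zpowers a)).exists_mem_center_orderOf_eq_of_normal N hN
  simp only [QuotientGroup.mk'_apply] at hcc hc2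
  have hca : c ∉ zpowers a := by
    intro h
    rw [(QuotientGroup.eq_one_iff c).mpr h, orderOf_one] at hc2
    omega
  have hcsq : c ^ 2 ∈ zpowers a := by
    rw [← QuotientGroup.eq_one_iff, QuotientGroup.mk_pow, ← hc2, pow_orderOf_eq_one]
  rcases hG.exists_sq_eq_or_mem_zpowers hcsq with ⟨d, hd, hdc⟩ | hac
  · have hcd : Commute c d := (hcA d hd).symm
    have h1 : (c * d⁻¹) ^ 2 = 1 := by
      rw [hcd.inv_right.mul_pow, inv_pow, hdc, mul_inv_cancel]
    have h2 : c * d⁻¹ ∈ zpowers a := by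
      rcases eq_one_or_eq_of_sq_eq_one hz h1 with h | h <;> rw [h]
      exacts [one_mem _, hza]
    exact hca ((mul_mem_cancel_right (inv_mem hd)).mp h2)
  · have hac' : a ∈ zpowers c := zpowers_le.mpr (pow_mem (mem_zpowers c) 2) hac
    refine hca (hmax c ?_ hac')
    refine ⟨?_⟩
    rintro _ ⟨i, rfl⟩ y
    have h1 : c⁻¹ * (y * c * y⁻¹) ∈ zpowers a := by
      rw [← QuotientGroup.eq_one_iff]
      simp only [QuotientGroup.mk_mul, QuotientGroup.mk_inv]
      rw [mem_center_iff.mp hcc]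
      group
    have h2 : y * c * y⁻¹ ∈ zpowers c :=
      (mul_mem_cancel_left (inv_mem (mem_zpowers c))).mp (zpowers_le.mpr hac' h1)
    simp only [← conj_zpow]
    exact zpow_mem h2 i

/-- In a finite 2-group with a unique involution `z`, an element which squares into a
self-centralizing cyclic normal subgroup acts on it by inversion, and has square `z`. -/
theorem conj_eq_inv_and_sq_eq [Finite G] (hG : IsPGroup 2 G) (hz2 : orderOf z = 2)
    (hz : ∀ y : G, orderOf y = 2 → y = z) {a : G} (ha : (zpowers a).Normal) (hza : z ∈ zpowers a)
    (hcent : ∀ g : G, Commute g a → g ∈ zpowers a)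
    {x : G} (hx : x ∉ zpowers a) (hx2 : x ^ 2 ∈ zpowers a) :
    x * a * x⁻¹ = a⁻¹ ∧ x ^ 2 = z := by
  obtain ⟨r, hr⟩ := mem_powers_iff_mem_zpowers.mpr (ha.conj_mem a (mem_zpowers a) x)
  replace hr : a ^ r = x * a * x⁻¹ := hr
  have hconj : ∀ b ∈ zpowers a, x * b * x⁻¹ = b ^ r := by
    rintro _ ⟨i, rfl⟩
    simp only
    rw [← conj_zpow, ← hr, ← zpow_natCast, ← zpow_natCast, zpow_comm]
  have hz1 : z ≠ 1 := by
    rintro rfl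
    simp at hz2
  have hzsq : z ^ 2 = 1 := hz2 ▸ pow_orderOf_eq_one z
  have hmem : ∀ y : G, y ^ 2 = 1 → y ∈ zpowers a := by
    intro y hy
    rcases eq_one_or_eq_of_sq_eq_one hz hy with rfl | rfl
    exacts [one_mem _, hza]
  have hnorm : ∀ b ∈ zpowers a, b ^ (1 + r) * x ^ 2 ≠ 1 := by
    intro b hb h
    have h1 : (b * x) ^ 2 = 1 := by
      rw [← h, pow_add, ← hconj b hb]
      simp [sq, mul_assoc]
    exact hx ((mul_mem_cancel_left hb).mp (hmem _ h1))
  have hodd : Odd r := by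
    rw [← Nat.not_even_iff_odd]
    rintro ⟨q, rfl⟩
    have h := hconj z hza
    rw [conj_eq_of_unique_involution hz2 hz, ← two_mul, pow_mul, hzsq, one_pow] at h
    exact hz1 h
  have hr4 : r % 4 = 1 ∨ r % 4 = 3 := by
    rw [Nat.odd_iff] at hodd
    omega
  rcases hr4 with hr4 | hr4
  · exfalso
    obtain ⟨q, rfl⟩ : ∃ q, r = 4 * q + 1 := ⟨r / 4, by omega⟩
    rcases hG.exists_sq_eq_or_mem_zpowers hx2 with ⟨d, hd, hdx⟩ | hax
    · obtain ⟨m, hm⟩ := hG.exists_pow_pow_eq_self_of_odd d (u := 2 * q + 1) ⟨q, rfl⟩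
      refine hnorm (d⁻¹ ^ m) (pow_mem (inv_mem hd) m) ?_
      have : (d⁻¹ ^ m) ^ (1 + (4 * q + 1)) = (((d ^ (2 * q + 1)) ^ m) ^ 2)⁻¹ := by
        simp only [← inv_pow, ← pow_mul]
        congr 1
        ring
      rw [this, hm, hdx, inv_mul_cancel]
    · obtain ⟨i, hi⟩ := hax
      refine hx (hcent x ?_)
      rw [← hi]
      exact ((Commute.refl x).pow_right 2).zpow_right i
  · obtain ⟨q, rfl⟩ : ∃ q, r = 4 * q + 3 := ⟨r / 4, by omega⟩
    have hxz : x ^ 2 = z := by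
      have h1 : (x ^ 2) ^ (4 * q + 3) = x ^ 2 := by
        rw [← hconj _ hx2]
        group
      have h2 : ((x ^ 2) ^ 2) ^ (2 * q + 1) = 1 := by
        rw [← pow_mul]
        rw [show 4 * q + 3 = 2 * (2 * q + 1) + 1 by ring, pow_succ] at h1
        exact mul_eq_right.mp h1
      obtain ⟨m, hm⟩ := hG.exists_pow_pow_eq_self_of_odd ((x ^ 2) ^ 2) (u := 2 * q + 1) ⟨q, rfl⟩
      rw [h2, one_pow] at hm
      exact (eq_one_or_eq_of_sq_eq_one hz hm.symm).resolve_left fun h => hx (hmem x h)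
    refine ⟨?_, hxz⟩
    have h1 : a ^ (1 + (4 * q + 3)) = 1 := by
      by_contra h
      obtain ⟨t, ht⟩ := hG.exists_pow_eq_involution hz h
      refine hnorm (a ^ t) (pow_mem (mem_zpowers a) t) ?_
      rw [pow_right_comm, ht, hxz, ← sq, hzsq]
    rw [← hr]
    rw [pow_add, pow_one] at h1
    exact (inv_eq_of_mul_eq_one_right h1).symm

end TwoGroup

/-- A group with a cyclic subgroup `⟨a⟩` of order `2n` and index 2, and an element `x` outside it
inverting `a` with `x² = aⁿ`, is a generalized quaternion group. -/
theorem QuaternionGroup.nonempty_mulEquiv {G : Type*} [Group G] {n : ℕ} {a x : G}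
    (ha : orderOf a = 2 * n) (hxa : x * a * x⁻¹ = a⁻¹) (hx2 : x ^ 2 = a ^ n)
    (hx : x ∉ zpowers a) (hcover : ∀ g : G, g ∈ zpowers a ∨ x⁻¹ * g ∈ zpowers a) :
    Nonempty (G ≃* QuaternionGroup n) := by
  have hpow : ∀ i j : ℤ, (i : ZMod (2 * n)) = j ↔ a ^ i = a ^ j := by
    intro i j
    rw [ZMod.intCast_eq_intCast_iff, zpow_eq_zpow_iff_modEq, ha]
  let e : ZMod (2 * n) → G := fun i => a ^ (i.cast : ℤ)
  have he : ∀ i : ℤ, e i = a ^ i := fun i => (hpow _ _).mp (by simp)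
  have hcomm : ∀ i : ℤ, a ^ i * x = x * a ^ (-i) := by
    intro i
    have h : x * a ^ (-i) * x⁻¹ = a ^ i := by
      rw [← conj_zpow, hxa, inv_zpow', neg_neg]
    rw [← h, inv_mul_cancel_right]
  let f : QuaternionGroup n → G
    | .a i => e i
    | .xa i => x * e i
  have hf : ∀ u v, f (u * v) = f u * f v := by
    rintro (i | i) (j | j) <;> obtain ⟨i, rfl⟩ := ZMod.intCast_surjective i <;>
      obtain ⟨j, rfl⟩ := ZMod.intCast_surjective j
    · simp only [QuaternionGroup.a_mul_a, f, ← Int.cast_add, he, zpow_add]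
    · simp only [QuaternionGroup.a_mul_xa, f, ← Int.cast_sub, he]
      rw [← mul_assoc, hcomm, mul_assoc, ← zpow_add, neg_add_eq_sub]
    · simp only [QuaternionGroup.xa_mul_a, f, ← Int.cast_add, he, zpow_add, mul_assoc]
    · simp only [QuaternionGroup.xa_mul_xa, f]
      rw [← Int.cast_natCast (R := ZMod (2 * n)), ← Int.cast_add, ← Int.cast_sub]
      simp only [he]
      rw [mul_assoc, ← mul_assoc (a ^ i), hcomm, mul_assoc, ← mul_assoc x, ← sq, hx2,
        ← zpow_natCast, ← zpow_add, ← zpow_add]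
      congr 1
      ring
  let F : QuaternionGroup n →* G := MonoidHom.mk' f hf
  have hinj : Function.Injective F := by
    rw [injective_iff_map_eq_one]
    rintro (i | i) h <;> obtain ⟨i, rfl⟩ := ZMod.intCast_surjective i
    · have h1 : a ^ i = a ^ (0 : ℤ) := by
        rw [← he, zpow_zero]
        exact h
      rw [(hpow _ _).mpr h1, Int.cast_zero, QuaternionGroup.a_zero]
    · have h1 : x * a ^ i = 1 := by
        rw [← he]
        exact h
      exact absurd (eq_inv_of_mul_eq_one_left h1 ▸ inv_mem (zpow_mem (mem_zpowers a) i)) hx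
  have hsurj : Function.Surjective F := by
    intro g
    rcases hcover g with ⟨i, hi⟩ | ⟨i, hi⟩
    · exact ⟨.a i, (he i).trans hi⟩
    · refine ⟨.xa i, ?_⟩
      change x * e i = g
      rw [he, show a ^ i = x⁻¹ * g from hi, mul_inv_cancel_left]
  exact ⟨(MulEquiv.ofBijective F ⟨hinj, hsurj⟩).symm⟩

theorem stmt_13 {G : Type*} [Group G] [Fintype G] (n : ℕ) (hn : 1 ≤ n)
    (hcard : Fintype.card G = 2 ^ n)
    (huniq : ∃! x : G, orderOf x = 2) :
    IsCyclic G ∨ ∃ m : ℕ, 1 ≤ m ∧ Nonempty (G ≃* QuaternionGroup (2 ^ m)) := by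
  obtain ⟨z, hz2, hz⟩ := huniq
  have hG : IsPGroup 2 G := IsPGroup.of_card (n := n) (by rw [Nat.card_eq_fintype_card, hcard])
  have hz1 : z ≠ 1 := by
    rintro rfl
    simp at hz2
  have hzn : (zpowers z).Normal := by
    refine ⟨?_⟩
    rintro _ ⟨i, rfl⟩ g
    simp only [← conj_zpow, conj_eq_of_unique_involution hz2 hz]
    exact zpow_mem (mem_zpowers z) i
  obtain ⟨a, ⟨ha, hza⟩, hamax⟩ := Set.exists_max_image
    {b : G | (zpowers b).Normal ∧ z ∈ zpowers b} orderOf (Set.toFinite _) ⟨z, hzn, mem_zpowers z⟩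
  have hcent : ∀ g : G, Commute g a → g ∈ zpowers a := fun g =>
    mem_zpowers_of_commute_of_maximal hG hz ha hza fun b hb hab => by
      have hle : zpowers a ≤ zpowers b := zpowers_le.mpr hab
      have hcardle := hamax b ⟨hb, hle hza⟩
      rw [← Nat.card_zpowers, ← Nat.card_zpowers] at hcardle
      rw [eq_of_le_of_card_ge hle hcardle]
      exact mem_zpowers b
  by_cases hall : ∀ g, g ∈ zpowers a
  · exact .inl ⟨a, hall⟩
  push Not at hall
  obtain ⟨x₀, hx₀⟩ := hall
  have hinv : ∀ x, x ∉ zpowers a → x ^ 2 ∈ zpowers a → x * a * x⁻¹ = a⁻¹ ∧ x ^ 2 = z :=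
    fun x => conj_eq_inv_and_sq_eq hG hz2 hz ha hza hcent
  obtain ⟨k, hk⟩ := IsPGroup.iff_orderOf.mp hG a
  have hk2 : 2 ≤ k := by
    by_contra h
    have h1 : a ^ 2 = 1 :=
      orderOf_dvd_iff_pow_eq_one.mp (hk ▸ pow_dvd_pow 2 (show k ≤ 1 by omega))
    refine hx₀ (hcent x₀ ?_)
    rcases eq_one_or_eq_of_sq_eq_one hz h1 with h2 | h2
    · rw [h2]
      exact Commute.one_right x₀
    · rw [h2]
      exact mul_inv_eq_iff_eq_mul.mp (conj_eq_of_unique_involution hz2 hz x₀)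
  have hdesc : ∀ y : G, y ^ 4 ∈ zpowers a → y ^ 2 ∈ zpowers a := by
    intro y hy
    by_contra hy2
    obtain ⟨h, -⟩ := hinv (y ^ 2) hy2 (by rwa [← pow_mul])
    obtain ⟨t, ht⟩ := mem_powers_iff_mem_zpowers.mpr (ha.conj_mem a (mem_zpowers a) y)
    replace ht : a ^ t = y * a * y⁻¹ := ht
    have h1 : y ^ 2 * a * (y ^ 2)⁻¹ = a ^ (t * t) := by
      rw [pow_mul, ht, conj_pow, ht, sq, mul_inv_rev]
      simp only [mul_assoc]
    have h2 : a ^ (t * t + 1) = 1 := by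
      rw [pow_succ, ← h1, h, inv_mul_cancel]
    have h3 : 4 ∣ t * t + 1 :=
      (pow_dvd_pow 2 hk2).trans (hk ▸ orderOf_dvd_of_pow_eq_one h2)
    have h4 : t % 4 = 0 ∨ t % 4 = 1 ∨ t % 4 = 2 ∨ t % 4 = 3 := by omega
    have h5 := Nat.mod_eq_zero_of_dvd h3
    rcases h4 with h4 | h4 | h4 | h4 <;> simp [Nat.add_mod, Nat.mul_mod, h4] at h5
  have hsq : ∀ y : G, y ^ 2 ∈ zpowers a := by
    intro y
    obtain ⟨j, hj⟩ := hG y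
    have hj' : y ^ 2 ^ j ∈ zpowers a := hj ▸ one_mem _
    clear hj
    induction j with
    | zero => exact pow_mem (by simpa using hj') 2
    | succ j ih =>
      cases j with
      | zero => simpa using hj'
      | succ j =>
        refine ih ?_
        rw [pow_succ, pow_mul]
        refine hdesc _ ?_
        rwa [← pow_mul, show 2 ^ j * 4 = 2 ^ (j + 1 + 1) by ring]
  obtain ⟨hxa, hxz⟩ := hinv x₀ hx₀ (hsq x₀)
  obtain ⟨m, rfl⟩ : ∃ m, k = m + 1 := ⟨k - 1, by omega⟩
  refine .inr ⟨m, by omega, QuaternionGroup.nonempty_mulEquiv (a := a) (x := x₀) ?_ hxa ?_ hx₀ ?_⟩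
  · rw [hk, pow_succ']
  · rw [hxz]
    refine ((eq_one_or_eq_of_sq_eq_one hz (y := a ^ 2 ^ m) ?_).resolve_left ?_).symm
    · rw [← pow_mul, ← pow_succ, ← hk, pow_orderOf_eq_one]
    · rw [← orderOf_dvd_iff_pow_eq_one, hk]
      exact Nat.not_dvd_of_pos_of_lt (by positivity) (Nat.pow_lt_pow_right (by omega) (by omega))
  · intro g
    by_cases hg : g ∈ zpowers a
    · exact .inl hg
    · refine .inr (hcent _ ?_)
      have h1 := (hinv g hg (hsq g)).1
      have h2 : x₀⁻¹ * g * a * (x₀⁻¹ * g)⁻¹ = a := by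
        have h3 : x₀⁻¹ * a⁻¹ * x₀ = a := by
          rw [← hxa]
          group
        rw [← h1] at h3
        simpa [mul_assoc] using h3
      exact mul_inv_eq_iff_eq_mul.mp h2
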